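/- Let W=(w_{ij}) be a positive real m×n matrix and let R=(r_1,…,r_m), C=(c_1,…,c_n) be positive integer vectors with |R|=|C|=N. Then T(R,C;W) ≥ (N!/N^{2N}) · ω(R) · ω(C) · ∫_{Mat(m,n)} f(G;R,C)^N dG, where dG is the exponential measure associated with W. -/

import Mathlib

open scoped BigOperators
open MeasureTheory

/-- The total weight `T(R,C;W)` of contingency tables with row sums `R`,
column sums `C`, and weight `∏ W i j ^ D i j` (with the convention `0 ^ 0 = 1`). -/
noncomputable def tableWeight {m n : ℕ} (R : Fin m → ℕ) (C : Fin n → ℕ)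
    (W : Fin m → Fin n → ℝ) : ℝ :=
  ∑' D : {D : Fin m → Fin n → ℕ //
      (∀ i, ∑ j, D i j = R i) ∧ (∀ j, ∑ i, D i j = C j)},
    ∏ i, ∏ j, W i j ^ D.1 i j

/-- `ω(B) = ∏ i, B i ^ (B i) / (B i)!` for a positive integer vector `B`. -/
noncomputable def omegaVec {l : ℕ} (B : Fin l → ℕ) : ℝ :=
  ∏ i, ((B i : ℝ) ^ (B i)) / (Nat.factorial (B i) : ℝ)

/-- `f(G;R,C)`: the infimum of `F(G;x,y) = ∑ i j, G i j * x i * y j` over positive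
vectors `x, y` satisfying `∏ i, x i ^ R i = 1` and `∏ j, y j ^ C j = 1`. -/
noncomputable def scalingInf {m n : ℕ} (G : Fin m → Fin n → ℝ)
    (R : Fin m → ℝ) (C : Fin n → ℝ) : ℝ :=
  sInf {z : ℝ | ∃ (x : Fin m → ℝ) (y : Fin n → ℝ),
    (∀ i, 0 < x i) ∧ (∀ j, 0 < y j) ∧
    (∏ i, x i ^ R i) = 1 ∧ (∏ j, y j ^ C j) = 1 ∧
    z = ∑ i, ∑ j, G i j * x i * y j}

/-- The exponential measure `dG` on `Mat(m,n)` associated with a positive matrix `W`: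
its density w.r.t. Lebesgue measure is `∏ i j, (W i j)⁻¹ exp (-(G i j) / W i j)` on
matrices with all entries positive, and `0` elsewhere. -/
noncomputable def expMeasure {m n : ℕ} (W : Fin m → Fin n → ℝ) :
    Measure (Fin m → Fin n → ℝ) :=
  volume.withDensity fun G =>
    ENNReal.ofReal (∏ i, ∏ j,
      if 0 < G i j then (W i j)⁻¹ * Real.exp (-(G i j) / W i j) else 0)

theorem Multiset.prod_le_arith_mean_pow (s : Multiset ℝ) (hs : ∀ x ∈ s, 0 ≤ x) :
    s.prod ≤ (s.sum / s.card) ^ s.card := by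
  have aux : ∀ (m : ℝ), 0 < m → ∀ s : Multiset ℝ, (∀ x ∈ s, 0 ≤ x) →
      s.prod ≤ m ^ s.card * Real.exp (s.sum / m - s.card) := by
    intro m hm s
    induction s using Multiset.induction with
    | empty => simp
    | cons a s ih =>
      intro h
      have ha : a ≤ m * Real.exp (a / m - 1) := by
        have := Real.add_one_le_exp (a / m - 1)
        calc a = m * (a / m - 1 + 1) := by field_simp; ring
          _ ≤ _ := by gcongr
      have hs := ih fun x hx => h x (Multiset.mem_cons_of_mem hx)
      have hs0 : 0 ≤ s.prod := Multiset.prod_nonneg fun x hx => h x (Multiset.mem_cons_of_mem hx)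
      rw [Multiset.prod_cons, Multiset.sum_cons, Multiset.card_cons]
      calc a * s.prod ≤ (m * Real.exp (a / m - 1)) *
            (m ^ s.card * Real.exp (s.sum / m - s.card)) := by gcongr
        _ = m ^ (s.card + 1) * (Real.exp (a / m - 1) * Real.exp (s.sum / m - s.card)) := by ring
        _ = _ := by
          rw [← Real.exp_add]; congr 2; push_cast; ring
  rcases (Multiset.sum_nonneg hs).eq_or_lt with h0 | h0
  · rcases s.empty_or_exists_mem with rfl | ⟨x, hx⟩
    · simp
    · have hx0 : x = 0 := le_antisymm (h0 ▸ Multiset.single_le_sum hs x hx) (hs x hx)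
      rw [Multiset.prod_eq_zero (hx0 ▸ hx)]
      rw [← h0]; positivity
  · have hc : 0 < s.card := by
      rw [Multiset.card_pos]; rintro rfl; simp at h0
    have hc' : (0 : ℝ) < s.card := by exact_mod_cast hc
    refine (aux (s.sum / s.card) (by positivity) s hs).trans_eq ?_
    rw [div_div_cancel₀ h0.ne']; simp

namespace Polynomial

theorem Splits.mul_le_eval_derivative_zero {R : ℝ[X]} (hR : R.Splits)
    (hroots : ∀ x ∈ R.roots, x < 0) (hd : 2 ≤ R.natDegree) {K : ℝ} (hK : 0 < K)
    (h : ∀ t > 0, K * t ≤ R.eval t) :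
    K * (((R.natDegree : ℝ) - 1) / R.natDegree) ^ (R.natDegree - 1) ≤ R.derivative.eval 0 := by
  obtain ⟨k, hk⟩ : ∃ k, R.natDegree = k + 2 := ⟨_, (Nat.sub_add_cancel hd).symm⟩
  have hcard : R.roots.card = k + 2 := by rw [← hR.natDegree_eq_card_roots, hk]
  have hR0 : R.eval 0 ≠ 0 := by
    intro h0
    have : (0 : ℝ) ∈ R.roots := by
      rw [mem_roots']; refine ⟨?_, h0⟩
      rintro rfl; simp at hk
    exact lt_irrefl _ (hroots 0 this)
  set S : ℝ := (R.roots.map fun z => 1 / (0 - z)).sum with hS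
  have hder : R.derivative.eval 0 = R.eval 0 * S := hR.eval_derivative_eq_eval_mul_sum hR0
  have hev : ∀ t, R.eval t = R.eval 0 * (R.roots.map fun z => 1 + t * (1 / (0 - z))).prod := by
    intro t
    rw [hR.eval_eq_prod_roots, hR.eval_eq_prod_roots, mul_assoc, ← Multiset.prod_map_mul]
    congr 2
    refine Multiset.map_congr rfl fun z hz => ?_
    have := (hroots z hz).ne
    field_simp
    ring
  have hterm : ∀ z ∈ R.roots, 0 < 1 / (0 - z) := fun z hz => by
    have := hroots z hz
    apply one_div_pos.2; linarith
  have hSpos : 0 < S := by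
    refine lt_of_le_of_ne (Multiset.sum_nonneg ?_) fun h0 => ?_
    · intro x hx
      obtain ⟨z, hz, rfl⟩ := Multiset.mem_map.1 hx
      exact (hterm z hz).le
    · obtain ⟨z, hz⟩ := Multiset.card_pos_iff_exists_mem.1
        (by rw [hcard]; omega : 0 < R.roots.card)
      have := Multiset.single_le_sum (s := R.roots.map fun z => 1 / (0 - z)) (by
        intro x hx
        obtain ⟨z, hz, rfl⟩ := Multiset.mem_map.1 hx
        exact (hterm z hz).le) _ (Multiset.mem_map_of_mem _ hz)
      have h2 := hterm z hz
      rw [← hS, ← h0] at this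
      linarith
  have hbound : ∀ t > 0, (R.roots.map fun z => 1 + t * (1 / (0 - z))).prod
      ≤ (1 + t * S / (k + 2)) ^ (k + 2) := by
    intro t ht
    have := Multiset.prod_le_arith_mean_pow (R.roots.map fun z => 1 + t * (1 / (0 - z))) (by
      intro x hx
      obtain ⟨z, hz, rfl⟩ := Multiset.mem_map.1 hx
      have := hterm z hz
      positivity)
    refine this.trans_eq ?_
    rw [Multiset.card_map, hcard, Multiset.sum_map_add, Multiset.sum_map_mul_left, ← hS]
    simp only [Multiset.map_const', Multiset.sum_replicate, hcard]
    congr 1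
    have : (k : ℝ) + 2 ≠ 0 := by positivity
    push_cast
    field_simp
    simp
  have hpos : 0 < R.eval 0 := by
    have h1 := h 1 one_pos
    rw [hev 1] at h1
    have h2 : 0 ≤ (R.roots.map fun z => 1 + 1 * (1 / (0 - z))).prod := by
      refine Multiset.prod_nonneg fun x hx => ?_
      obtain ⟨z, hz, rfl⟩ := Multiset.mem_map.1 hx
      have := hterm z hz
      positivity
    by_contra hneg
    have := mul_nonpos_of_nonpos_of_nonneg (not_lt.1 hneg) h2
    linarith
  have ht0 : (0 : ℝ) < (k + 2) / (S * (k + 1)) := by positivity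
  have key := (h _ ht0).trans ((hev _).le.trans
    (mul_le_mul_of_nonneg_left (hbound _ ht0) hpos.le))
  have e1 : 1 + (k + 2) / (S * (k + 1)) * S / ((k : ℝ) + 2) = (k + 2) / (k + 1) := by
    field_simp
    ring
  rw [e1] at key
  rw [hder, hk]
  have e2 : (((k + 2 : ℕ) : ℝ) - 1) / ((k + 2 : ℕ) : ℝ) = (k + 1) / (k + 2) := by
    push_cast; ring
  rw [e2, show k + 2 - 1 = k + 1 from rfl]
  have e3 : ((k : ℝ) + 1) / (k + 2) = (((k : ℝ) + 2) / (k + 1))⁻¹ := (inv_div _ _).symm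
  set q : ℝ := (k + 2) / (k + 1) with hq
  have hq0 : 0 < q := by positivity
  rw [e3, inv_pow, ← div_eq_mul_inv, div_le_iff₀ (by positivity)]
  refine le_of_mul_le_mul_right ?_ (div_pos hq0 hSpos)
  calc K * (q / S) = K * ((k + 2) / (S * (k + 1))) := by rw [hq]; field_simp
    _ ≤ _ := key
    _ = _ := by rw [pow_succ q (k + 1)]; field_simp

end Polynomial

namespace MvPolynomial

variable {σ : Type*}

theorem IsHomogeneous.aeval_smul {A : Type*} [CommRing A] [Algebra ℝ A] (z : σ → A)
    {p : MvPolynomial σ ℝ} {d : ℕ}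
    (hp : p.IsHomogeneous d) (l : A) :
    MvPolynomial.aeval (l • z) p = l ^ d * MvPolynomial.aeval z p := by
  rw [p.as_sum, map_sum, map_sum, Finset.mul_sum]
  refine Finset.sum_congr rfl fun s hs => ?_
  have hsd : s.degree = d := by_contra fun h => mem_support_iff.1 hs (hp.coeff_eq_zero h)
  rw [aeval_monomial, aeval_monomial, ← hsd, Finsupp.degree_apply, ← Finset.prod_pow_eq_pow_sum]
  simp only [Finsupp.prod, Pi.smul_apply, smul_eq_mul, mul_pow, Finset.prod_mul_distrib]
  ring

/-- A real polynomial is strictly stable if it has no zeros in the closed right half-plane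
polydomain other than those with all coordinates purely imaginary. -/
def StrictlyStable (p : MvPolynomial σ ℝ) : Prop :=
  ∀ z : σ → ℂ, (∀ i, 0 ≤ (z i).re) → (∃ i, 0 < (z i).re) → aeval z p ≠ 0

variable [DecidableEq σ]

/-- The restriction of a real polynomial to the line through `z` in the direction of the `j`-th
coordinate, as a univariate polynomial. -/
noncomputable def coordLine {A : Type*} [CommRing A] [Algebra ℝ A] (z : σ → A) (j : σ) :
    MvPolynomial σ ℝ →ₐ[ℝ] Polynomial A :=
  aeval fun i => Polynomial.C (z i) + Polynomial.C ((Pi.single j 1 : σ → A) i) * Polynomial.X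

section coordLine

variable {A : Type*} [CommRing A] [Algebra ℝ A] (z : σ → A) (j : σ) (p : MvPolynomial σ ℝ)

theorem eval_coordLine (t : A) :
    (coordLine z j p).eval t = aeval (z + Pi.single j t) p := by
  have h : ((Polynomial.aeval t).restrictScalars ℝ).comp (coordLine z j)
      = aeval (z + Pi.single j t) := by
    ext i
    by_cases hi : i = j
    · subst hi; simp [coordLine]
    · simp [coordLine, hi]
  rw [← h]; simp

theorem derivative_coordLine :
    (coordLine z j p).derivative = coordLine z j (pderiv j p) := by
  induction p using MvPolynomial.induction_on with
  | C a => simp [coordLine, Polynomial.algebraMap_apply]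
  | add p q hp hq => simp [hp, hq]
  | mul_X p i hp =>
    have hX : (coordLine z j (X i)).derivative = coordLine z j (pderiv j (X i)) := by
      by_cases hi : i = j
      · subst hi; simp [coordLine]
      · simp [coordLine, hi, pderiv_X_of_ne hi]
    rw [pderiv_mul, map_mul, Polynomial.derivative_mul, map_add, map_mul, map_mul, hp, hX]

theorem IsHomogeneous.natDegree_coordLine_le {p : MvPolynomial σ ℝ} {d : ℕ}
    (hp : p.IsHomogeneous d) : (coordLine z j p).natDegree ≤ d := by
  rw [p.as_sum, map_sum]
  refine Polynomial.natDegree_sum_le_of_forall_le _ _ fun s hs => ?_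
  have hsd : s.degree = d := by_contra fun h => mem_support_iff.1 hs (hp.coeff_eq_zero h)
  rw [coordLine, aeval_monomial, Polynomial.algebraMap_apply, ← hsd]
  refine (Polynomial.natDegree_C_mul_le _ _).trans ?_
  refine (Polynomial.natDegree_prod_le _ _).trans ?_
  rw [Finsupp.degree]
  refine Finset.sum_le_sum fun i _ => Polynomial.natDegree_pow_le_of_le _ ?_ |>.trans_eq (mul_one _)
  compute_degree

theorem IsHomogeneous.coeff_coordLine {p : MvPolynomial σ ℝ} {d : ℕ}
    (hp : p.IsHomogeneous d) :
    (coordLine z j p).coeff d = MvPolynomial.aeval (Pi.single j 1 : σ → A) p := by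
  conv_lhs => rw [p.as_sum]
  conv_rhs => rw [p.as_sum]
  simp only [map_sum, Polynomial.finsetSum_coeff]
  refine Finset.sum_congr rfl fun s hs => ?_
  have hsd : s.degree = d := by_contra fun h => mem_support_iff.1 hs (hp.coeff_eq_zero h)
  rw [coordLine, aeval_monomial, aeval_monomial, Polynomial.algebraMap_apply,
    Polynomial.coeff_C_mul]
  congr 1
  have h := Polynomial.coeff_multiset_prod_of_natDegree_le
    ((Finsupp.toMultiset s).map fun i => Polynomial.C (z i) +
      Polynomial.C ((Pi.single j 1 : σ → A) i) * Polynomial.X) 1 (by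
        intro q hq
        obtain ⟨i, -, rfl⟩ := Multiset.mem_map.1 hq
        compute_degree)
  rw [Multiset.card_map, Finsupp.card_toMultiset, mul_one, Multiset.map_map] at h
  rw [← hsd]
  have hcard : (s.sum fun _ => id) = s.degree := rfl
  have hprod : ∀ {B : Type _} [CommRing B] (g : σ → B),
      ((Finsupp.toMultiset s).map g).prod = s.prod fun i n => g i ^ n := fun g => by
    rw [Finsupp.toMultiset_map, Finsupp.prod_toMultiset, Finsupp.prod_mapDomain_index] <;>
      simp [pow_add]
  rw [hprod, hprod, hcard] at h
  rw [h]
  simp [Finsupp.prod, Polynomial.coeff_C]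

end coordLine

namespace StrictlyStable

variable {p : MvPolynomial σ ℝ}

theorem coeff_coordLine_ne_zero (hp : p.StrictlyStable) {d : ℕ} (hd : p.IsHomogeneous d)
    (z : σ → ℂ) (j : σ) : (coordLine z j p).coeff d ≠ 0 := by
  rw [hd.coeff_coordLine]
  refine hp _ (fun i => ?_) ⟨j, by simp⟩
  by_cases hi : i = j
  · subst hi; simp
  · simp [hi]

theorem natDegree_coordLine (hp : p.StrictlyStable) {d : ℕ} (hd : p.IsHomogeneous d)
    (z : σ → ℂ) (j : σ) : (coordLine z j p).natDegree = d :=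
  le_antisymm (hd.natDegree_coordLine_le z j)
    (Polynomial.le_natDegree_of_ne_zero (hp.coeff_coordLine_ne_zero hd z j))

theorem pderiv (hp : p.StrictlyStable) {d : ℕ} (hd : p.IsHomogeneous (d + 1)) (j : σ) :
    (MvPolynomial.pderiv j p).StrictlyStable := by
  intro z h0 ⟨i, hi⟩ hz
  have hdeg := hp.natDegree_coordLine hd z j
  have h1 : (0 : ℂ) ∈ (coordLine z j p).derivative.rootSet ℂ := by
    rw [Polynomial.mem_rootSet]
    refine ⟨fun h => ?_, ?_⟩
    · have := Polynomial.derivative_eq_zero.1 h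
      omega
    · rw [derivative_coordLine, Polynomial.coe_aeval_eq_eval, eval_coordLine]
      simpa using hz
  have h2 := Polynomial.rootSet_derivative_subset_convexHull_rootSet
    (Polynomial.natDegree_pos_iff_degree_pos.1 (by omega)) h1
  have h3 : convexHull ℝ ((coordLine z j p).rootSet ℂ) ⊆ {t : ℂ | t.re < 0} := by
    refine convexHull_min (fun t ht => ?_) (convex_halfSpace_re_lt 0)
    by_contra hneg
    have hre : 0 ≤ t.re := not_lt.1 hneg
    have := (Polynomial.mem_rootSet.1 ht).2
    rw [Polynomial.coe_aeval_eq_eval, eval_coordLine] at this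
    refine hp _ (fun l => ?_) ⟨i, ?_⟩ this
    · by_cases hl : l = j
      · subst hl; simpa using add_nonneg (h0 l) hre
      · simpa [hl] using h0 l
    · by_cases hl : i = j
      · subst hl; simpa using add_pos_of_pos_of_nonneg hi hre
      · simpa [hl] using hi
  have := h3 h2
  simp at this

theorem root_coordLine (hp : p.StrictlyStable) {d : ℕ} (hd : p.IsHomogeneous d)
    {v : σ → ℝ} (hv : ∀ i, 0 ≤ v i) (hv' : ∃ i, 0 < v i) (j : σ) {t : ℂ}
    (ht : aeval ((fun i => (v i : ℂ)) + Pi.single j t) p = 0) : ∃ x : ℝ, x < 0 ∧ (x : ℂ) = t := by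
  by_contra hcon
  have hpos : 0 < ‖t‖ + t.re ∨ t = 0 := by
    by_contra! h
    have h1 := Complex.abs_re_le_norm t
    have h2 : t.re = -‖t‖ := by linarith [neg_abs_le t.re]
    refine hcon ⟨t.re, ?_, ?_⟩
    · rw [h2]; simpa using h.2
    · apply Complex.ext
      · simp
      · have := Complex.abs_re_eq_norm.1 (by rw [h2]; simp : |t.re| = ‖t‖)
        simp [this]
  obtain ⟨i, hi⟩ := hv'
  rcases hpos with hpos | rfl
  · set l : ℂ := (starRingEnd ℂ) t + ‖t‖ with hl
    have hlre : l.re = ‖t‖ + t.re := by simp [hl, add_comm]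
    have hlt : (l * t).re = ‖t‖ * (‖t‖ + t.re) := by
      have := Complex.sq_norm t
      rw [Complex.normSq_apply] at this
      simp [hl]
      linarith
    have hhom : aeval (l • ((fun i => (v i : ℂ)) + Pi.single j t)) p = 0 := by
      rw [hd.aeval_smul, ht, mul_zero]
    have hnn : ∀ k, 0 ≤ (l * (Pi.single j t : σ → ℂ) k).re := by
      intro k
      by_cases hk : k = j
      · subst hk; rw [Pi.single_eq_same, hlt]; positivity
      · simp [hk]
    have hre : ∀ k, (l * (v k : ℂ)).re = l.re * v k := fun k => by simp
    refine hp _ (fun k => ?_) ⟨i, ?_⟩ hhom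
    · simp only [Pi.smul_apply, Pi.add_apply, smul_eq_mul, mul_add, Complex.add_re, hre, hlre]
      exact add_nonneg (mul_nonneg hpos.le (hv k)) (hnn k)
    · simp only [Pi.smul_apply, Pi.add_apply, smul_eq_mul, mul_add, Complex.add_re, hre, hlre]
      exact add_pos_of_pos_of_nonneg (mul_pos hpos hi) (hnn i)
  · exact hp _ (fun k => by simpa using hv k) ⟨i, by simpa using hi⟩ ht

theorem mul_le_eval_pderiv (hp : p.StrictlyStable) {d : ℕ} (hd : p.IsHomogeneous (d + 1))
    {v : σ → ℝ} (hv : ∀ i, 0 ≤ v i) (hv' : d = 0 ∨ ∃ i, 0 < v i) (j : σ) {K : ℝ} (hK : 0 < K)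
    (h : ∀ t > 0, K * t ≤ eval (v + Pi.single j t) p) :
    K * ((d : ℝ) / (d + 1)) ^ d ≤ eval v (MvPolynomial.pderiv j p) := by
  have hder : eval v (MvPolynomial.pderiv j p) = (coordLine v j p).derivative.eval 0 := by
    rw [derivative_coordLine, eval_coordLine, Pi.single_zero, add_zero]
    rfl
  have hev : ∀ t, eval (v + Pi.single j t) p = (coordLine v j p).eval t := fun t => by
    rw [eval_coordLine]; rfl
  simp only [hev] at h
  rw [hder]
  have hle := hd.natDegree_coordLine_le v j
  have hmap : (coordLine v j p).map Complex.ofRealHom = coordLine (fun i => (v i : ℂ)) j p := by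
    have : (Polynomial.mapAlgHom (Complex.ofRealAm)).comp (coordLine v j)
      = coordLine (fun i => (v i : ℂ)) j := by
      ext i : 1
      by_cases hi : i = j
      · subst hi; simp [coordLine]
      · simp [coordLine, hi]
    rw [← this]; rfl
  rcases Nat.eq_zero_or_pos d with rfl | hd0
  · obtain ⟨a, b, hC⟩ : ∃ a b, coordLine v j p = Polynomial.C a * Polynomial.X + Polynomial.C b :=
      ⟨_, _, Polynomial.eq_X_add_C_of_natDegree_le_one hle⟩
    rw [hC] at h ⊢
    simp only [Polynomial.eval_add, Polynomial.eval_mul, Polynomial.eval_C, Polynomial.eval_X] at h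
    simp
    by_contra! hlt
    have h1 := h ((|b| + 1) / (K - a)) (div_pos (by positivity) (by linarith))
    have h2 : (K - a) * ((|b| + 1) / (K - a)) = |b| + 1 := mul_div_cancel₀ _ (by linarith)
    nlinarith [le_abs_self b]
  · have hv'' := hv'.resolve_left hd0.ne'
    have hdeg : (coordLine v j p).natDegree = d + 1 := by
      rw [← hp.natDegree_coordLine hd (fun i => (v i : ℂ)) j, ← hmap,
        Polynomial.natDegree_map]
    have hroot : ∀ t : ℂ, t ∈ ((coordLine v j p).map Complex.ofRealHom).roots →
        ∃ x : ℝ, x < 0 ∧ (x : ℂ) = t := by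
      intro t ht
      have := (Polynomial.mem_roots'.1 ht).2
      rw [hmap, Polynomial.IsRoot, eval_coordLine] at this
      exact hp.root_coordLine hd hv hv'' j this
    have hsplit : (coordLine v j p).Splits := by
      refine Polynomial.Splits.of_splits_map Complex.ofRealHom (IsAlgClosed.splits _) fun t ht => ?_
      obtain ⟨x, -, hx⟩ := hroot t ht
      exact ⟨x, hx⟩
    have := hsplit.mul_le_eval_derivative_zero (fun x hx => ?_) (by omega) hK h
    · rw [hdeg] at this
      simpa using this
    · obtain ⟨y, hy, hxy⟩ := hroot x (by
        rw [hsplit.roots_map]; exact Multiset.mem_map_of_mem _ hx)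
      rwa [← Complex.ofReal_injective hxy]

theorem capacity_mul_le_coeff [Fintype σ] (hp : p.StrictlyStable) {d : ℕ}
    (hd : p.IsHomogeneous d) {c : σ →₀ ℕ} (hc : ∑ i, c i = d) {K : ℝ} (hK : 0 < K)
    (h : ∀ y : σ → ℝ, (∀ i, 0 < y i) → K * ∏ i, y i ^ c i ≤ eval (fun i => c i * y i) p) :
    K * (d.factorial / (d : ℝ) ^ d) ≤ (∏ i, ((c i).factorial : ℝ)) * coeff c p := by
  induction d generalizing p c K with
  | zero =>
    have hc0 : c = 0 := by
      ext i
      exact Finset.sum_eq_zero_iff.1 hc i (Finset.mem_univ i)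
    subst hc0
    have hC : p = C (coeff 0 p) :=
      totalDegree_eq_zero_iff_eq_C.1 ((totalDegree_zero_iff_isHomogeneous σ).2 hd)
    have := h (fun _ => 1) (fun _ => one_pos)
    rw [hC] at this
    simpa using this
  | succ d ih =>
    obtain ⟨j, hj⟩ : ∃ j, c j ≠ 0 := by
      by_contra! h0
      simp [h0] at hc
    obtain ⟨c', rfl⟩ : ∃ c', c = c' + Finsupp.single j 1 :=
      ⟨c - Finsupp.single j 1,
        (tsub_add_cancel_of_le (by simpa using Nat.one_le_iff_ne_zero.2 hj)).symm⟩
    have hc' : ∑ i, c' i = d := by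
      simpa [Finset.sum_add_distrib, Finsupp.single_apply] using hc
    have hK' : 0 < K * ((d : ℝ) / (d + 1)) ^ d := by
      rcases Nat.eq_zero_or_pos d with rfl | hd0
      · simpa
      · positivity
    have hstep : ∀ y : σ → ℝ, (∀ i, 0 < y i) →
        K * ((d : ℝ) / (d + 1)) ^ d * ∏ i, y i ^ c' i ≤
          eval (fun i => c' i * y i) (MvPolynomial.pderiv j p) := by
      intro y hy
      have hprod : 0 < ∏ i, y i ^ c' i := Finset.prod_pos fun i _ => pow_pos (hy i) _
      rw [mul_right_comm]
      refine hp.mul_le_eval_pderiv hd (fun i => mul_nonneg (Nat.cast_nonneg _) (hy i).le) ?_ j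
        (mul_pos hK hprod) fun t ht => ?_
      · by_contra! hcon
        obtain ⟨i, hi⟩ : ∃ i, c' i ≠ 0 := by
          by_contra! h0
          simp [h0] at hc'
          exact hcon.1 hc'.symm
        have h1 := hcon.2 i
        have h2 : (0 : ℝ) < c' i := by exact_mod_cast Nat.pos_of_ne_zero hi
        have := mul_pos h2 (hy i)
        linarith
      · set u : ℝ := (c' j * y j + t) / (c' j + 1) with hu
        have hu0 : 0 < u := div_pos (add_pos_of_nonneg_of_pos
          (mul_nonneg (Nat.cast_nonneg _) (hy j).le) ht) (by positivity)
        have hamgm : y j ^ c' j * t ≤ u ^ (c' j + 1) := by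
          have := Multiset.prod_le_arith_mean_pow (t ::ₘ Multiset.replicate (c' j) (y j)) (by
            intro x hx
            rcases Multiset.mem_cons.1 hx with rfl | hx
            · exact ht.le
            · rw [Multiset.eq_of_mem_replicate hx]; exact (hy j).le)
          simp only [Multiset.prod_cons, Multiset.prod_replicate, Multiset.sum_cons,
            Multiset.sum_replicate, Multiset.card_cons, Multiset.card_replicate, nsmul_eq_mul,
            Nat.cast_add, Nat.cast_one] at this
          rw [hu, mul_comm, add_comm (_ * _)]
          exact this
        have hval := h (Function.update y j u) (fun i => by
          by_cases hi : i = j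
          · subst hi; simpa using hu0
          · simpa [hi] using hy i)
        have harg : (fun i => ((c' + Finsupp.single j 1 : σ →₀ ℕ) i : ℝ) * Function.update y j u i)
            = (fun i => (c' i : ℝ) * y i) + Pi.single j t := by
          ext i
          by_cases hi : i = j
          · subst hi
            simp [hu]
            field_simp
          · simp [hi]
        rw [harg] at hval
        refine le_trans ?_ hval
        rw [mul_assoc]
        refine mul_le_mul_of_nonneg_left ?_ hK.le
        rw [← Finset.mul_prod_erase _ _ (Finset.mem_univ j),
          ← Finset.mul_prod_erase (a := j) _ _ (Finset.mem_univ j), mul_right_comm]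
        have herase : ∏ i ∈ Finset.univ.erase j,
            Function.update y j u i ^ (c' + Finsupp.single j 1 : σ →₀ ℕ) i =
            ∏ i ∈ Finset.univ.erase j, y i ^ c' i := by
          refine Finset.prod_congr rfl fun i hi => ?_
          have := Finset.ne_of_mem_erase hi
          simp [this]
        rw [herase]
        refine mul_le_mul_of_nonneg_right ?_
          (Finset.prod_nonneg fun i _ => (pow_pos (hy i) _).le)
        simpa using hamgm
    have key := ih (hp.pderiv hd j) hd.pderiv hc' hK' hstep
    rw [coeff_pderiv] at key
    convert key using 1
    · rcases Nat.eq_zero_or_pos d with rfl | hd0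
      · simp
      · rw [Nat.factorial_succ, div_pow]
        push_cast
        field_simp
        ring
    · have hfac : ∏ i, (((c' + Finsupp.single j 1 : σ →₀ ℕ) i).factorial : ℝ) =
          (∏ i, ((c' i).factorial : ℝ)) * (c' j + 1) := by
        rw [← Finset.mul_prod_erase _ _ (Finset.mem_univ j),
          ← Finset.mul_prod_erase (a := j) _ (fun i => ((c' i).factorial : ℝ)) (Finset.mem_univ j)]
        have herase : ∏ i ∈ Finset.univ.erase j,
            (((c' + Finsupp.single j 1 : σ →₀ ℕ) i).factorial : ℝ) =
            ∏ i ∈ Finset.univ.erase j, ((c' i).factorial : ℝ) := by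
          refine Finset.prod_congr rfl fun i hi => ?_
          have := Finset.ne_of_mem_erase hi
          simp [Ne.symm this]
        rw [herase]
        simp [Nat.factorial_succ]
        ring
      rw [hfac]
      ring

end StrictlyStable

end MvPolynomial

section ContingencyTables

variable {m n : ℕ}

/-- The finite set of contingency tables with row sums `R` and column sums `C`. -/
def contingencyTables (R : Fin m → ℕ) (C : Fin n → ℕ) : Finset (Fin m → Fin n → ℕ) :=
  (Fintype.piFinset fun i => Finset.univ.piAntidiag (R i)).filter fun D => ∀ j, ∑ i, D i j = C j

theorem mem_contingencyTables {R : Fin m → ℕ} {C : Fin n → ℕ} {D : Fin m → Fin n → ℕ} :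
    D ∈ contingencyTables R C ↔ (∀ i, ∑ j, D i j = R i) ∧ ∀ j, ∑ i, D i j = C j := by
  simp [contingencyTables, Fintype.mem_piFinset, Finset.mem_piAntidiag]

theorem tableWeight_eq_sum (R : Fin m → ℕ) (C : Fin n → ℕ) (W : Fin m → Fin n → ℝ) :
    tableWeight R C W = ∑ D ∈ contingencyTables R C, ∏ i, ∏ j, W i j ^ D i j := by
  rw [tableWeight, ← Finset.tsum_subtype (contingencyTables R C)
    fun D => ∏ i, ∏ j, W i j ^ D i j]
  exact (Equiv.subtypeEquivRight fun D => mem_contingencyTables.symm).tsum_eq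
    (fun D : {D // D ∈ contingencyTables R C} => ∏ i, ∏ j, W i j ^ D.1 i j)

open MvPolynomial in
/-- The product over the rows of `G` of the `R i`-th powers of the linear forms with coefficients
given by the rows. -/
noncomputable def rowPolynomial (G : Fin m → Fin n → ℝ) (R : Fin m → ℕ) :
    MvPolynomial (Fin n) ℝ :=
  ∏ i, (∑ j, C (G i j) * X j) ^ R i

theorem rowPolynomial_isHomogeneous (G : Fin m → Fin n → ℝ) (R : Fin m → ℕ) :
    (rowPolynomial G R).IsHomogeneous (∑ i, R i) := by
  refine MvPolynomial.IsHomogeneous.prod _ _ _ fun i _ => ?_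
  have := (MvPolynomial.IsHomogeneous.sum Finset.univ
    (fun j => MvPolynomial.C (G i j) * MvPolynomial.X j) 1
    fun j _ => MvPolynomial.isHomogeneous_C_mul_X (G i j) j).pow (R i)
  simpa using this

theorem rowPolynomial_strictlyStable {G : Fin m → Fin n → ℝ} (hG : ∀ i j, 0 < G i j)
    (R : Fin m → ℕ) : (rowPolynomial G R).StrictlyStable := by
  rintro z h0 ⟨l, hl⟩
  simp only [rowPolynomial, map_prod, map_pow, map_sum, map_mul, MvPolynomial.aeval_C,
    MvPolynomial.aeval_X]
  refine Finset.prod_ne_zero_iff.2 fun i _ => pow_ne_zero _ fun h => ?_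
  have := congrArg Complex.re h
  simp only [Complex.coe_algebraMap, Complex.re_sum, Complex.re_ofReal_mul, Complex.zero_re] at this
  have hpos : 0 < ∑ j, G i j * (z j).re :=
    Finset.sum_pos' (fun j _ => mul_nonneg (hG i j).le (h0 j))
      ⟨l, Finset.mem_univ l, mul_pos (hG i l) hl⟩
  exact hpos.ne' this

theorem coeff_rowPolynomial (G : Fin m → Fin n → ℝ) (R : Fin m → ℕ) (c : Fin n →₀ ℕ) :
    (rowPolynomial G R).coeff c = ∑ D ∈ contingencyTables R c,
      (∏ i, (Nat.multinomial Finset.univ (D i) : ℝ)) * ∏ i, ∏ j, G i j ^ D i j := by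
  have hmon : ∀ D : Fin m → Fin n → ℕ, ∏ i, ((Nat.multinomial Finset.univ (D i) :
      MvPolynomial (Fin n) ℝ) * ∏ j, (MvPolynomial.C (G i j) * MvPolynomial.X j) ^ D i j) =
      MvPolynomial.monomial (Finsupp.equivFunOnFinite.symm fun j => ∑ i, D i j)
        ((∏ i, (Nat.multinomial Finset.univ (D i) : ℝ)) * ∏ i, ∏ j, G i j ^ D i j) := by
    intro D
    rw [MvPolynomial.monomial_eq, Finsupp.prod_fintype _ _ (fun _ => pow_zero _)]
    simp only [mul_pow, Finset.prod_mul_distrib, map_mul, map_prod, map_pow, map_natCast,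
      Finsupp.equivFunOnFinite_symm_apply_apply]
    rw [mul_assoc]
    congr 2
    rw [Finset.prod_comm]
    simp only [Finset.prod_pow_eq_pow_sum]
  simp only [rowPolynomial, Finset.sum_pow_eq_sum_piAntidiag, Finset.prod_univ_sum, hmon,
    MvPolynomial.coeff_sum, MvPolynomial.coeff_monomial]
  rw [contingencyTables, Finset.sum_filter]
  refine Finset.sum_congr rfl fun D _ => if_congr ?_ rfl rfl
  simp [Finsupp.ext_iff]

theorem scalingInf_nonneg {G : Fin m → Fin n → ℝ} (hG : ∀ i j, 0 < G i j)
    (R : Fin m → ℝ) (C : Fin n → ℝ) : 0 ≤ scalingInf G R C := by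
  refine Real.sInf_nonneg ?_
  rintro _ ⟨x, y, hx, hy, -, -, rfl⟩
  exact Finset.sum_nonneg fun i _ => Finset.sum_nonneg fun j _ =>
    mul_nonneg (mul_nonneg (hG i j).le (hx i).le) (hy j).le

theorem scalingInf_pow_mul_le {N : ℕ} {G : Fin m → Fin n → ℝ} (hG : ∀ i j, 0 < G i j)
    {R : Fin m → ℕ} {C : Fin n → ℕ} (hR : ∀ i, 0 < R i)
    (hRN : ∑ i, R i = N) (hCN : ∑ j, C j = N) {u : Fin n → ℝ} (hu : ∀ j, 0 < u j) :
    scalingInf G (fun i => (R i : ℝ)) (fun j => (C j : ℝ)) ^ N * (∏ i, (R i : ℝ) ^ R i)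
      / (N : ℝ) ^ N * ∏ j, u j ^ C j ≤ ∏ i, (∑ j, G i j * u j) ^ R i := by
  rcases Nat.eq_zero_or_pos N with rfl | hN
  · have hC0 : ∀ j, C j = 0 := by simpa using hCN
    have hR0 : ∀ i, R i = 0 := by simpa using hRN
    simp [hC0, hR0]
  have hN' : (0 : ℝ) < N := by exact_mod_cast hN
  have hs : ∀ i, 0 < ∑ j, G i j * u j := by
    intro i
    obtain ⟨j, -, -⟩ : ∃ j ∈ Finset.univ, C j ≠ 0 :=
      Finset.exists_ne_zero_of_sum_ne_zero (by omega)
    exact Finset.sum_pos (fun j _ => mul_pos (hG i j) (hu j)) ⟨j, Finset.mem_univ j⟩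
  set s : Fin m → ℝ := fun i => ∑ j, G i j * u j with hsdef
  have hR' : ∀ i, (0 : ℝ) < R i := fun i => by exact_mod_cast hR i
  set A : ℝ := ∏ i, (s i / R i) ^ R i with hA
  set B : ℝ := ∏ j, u j ^ C j with hB
  have hA0 : 0 < A := Finset.prod_pos fun i _ => pow_pos (div_pos (hs i) (hR' i)) _
  have hB0 : 0 < B := Finset.prod_pos fun j _ => pow_pos (hu j) _
  set ρ : ℝ := A ^ ((N : ℝ)⁻¹) with hρ
  set τ : ℝ := B ^ ((N : ℝ)⁻¹) with hτ
  have hρ0 : 0 < ρ := Real.rpow_pos_of_pos hA0 _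
  have hτ0 : 0 < τ := Real.rpow_pos_of_pos hB0 _
  have hρN : ρ ^ N = A := Real.rpow_inv_natCast_pow hA0.le hN.ne'
  have hτN : τ ^ N = B := Real.rpow_inv_natCast_pow hB0.le hN.ne'
  have hle : scalingInf G (fun i => (R i : ℝ)) (fun j => (C j : ℝ)) ≤ N * ρ / τ := by
    refine csInf_le ⟨0, ?_⟩ ⟨fun i => R i / s i * ρ, fun j => u j / τ,
      fun i => mul_pos (div_pos (hR' i) (hs i)) hρ0, fun j => div_pos (hu j) hτ0, ?_, ?_, ?_⟩
    · rintro _ ⟨x, y, hx, hy, -, -, rfl⟩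
      exact Finset.sum_nonneg fun i _ => Finset.sum_nonneg fun j _ =>
        mul_nonneg (mul_nonneg (hG i j).le (hx i).le) (hy j).le
    · simp only [Real.rpow_natCast, mul_pow, Finset.prod_mul_distrib, Finset.prod_pow_eq_pow_sum,
        hRN, hρN]
      rw [hA, ← Finset.prod_mul_distrib]
      refine Finset.prod_eq_one fun i _ => ?_
      have := (hs i).ne'
      have := (hR' i).ne'
      rw [← mul_pow, div_mul_div_comm, mul_comm, div_self (by positivity), one_pow]
    · simp only [Real.rpow_natCast, div_pow, Finset.prod_div_distrib, Finset.prod_pow_eq_pow_sum,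
        hCN, hτN]
      exact div_self hB0.ne'
    · have hrow : ∀ i, ∑ j, G i j * (R i / s i * ρ) * (u j / τ) = R i * (ρ / τ) := by
        intro i
        have h1 : ∑ j, G i j * (R i / s i * ρ) * (u j / τ) = s i * (R i / s i * ρ / τ) := by
          rw [hsdef, Finset.sum_mul]
          exact Finset.sum_congr rfl fun j _ => by ring
        have hsi : s i ≠ 0 := (hs i).ne'
        rw [h1]
        field_simp
      simp only [hrow, ← Finset.sum_mul, ← Nat.cast_sum, hRN]
      ring
  have hpow : scalingInf G (fun i => (R i : ℝ)) (fun j => (C j : ℝ)) ^ N ≤ N ^ N * A / B := by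
    refine (pow_le_pow_left₀ (scalingInf_nonneg hG _ _) hle N).trans_eq ?_
    rw [div_pow, mul_pow, hρN, hτN]
  have hP : 0 < ∏ i, (R i : ℝ) ^ R i := Finset.prod_pos fun i _ => pow_pos (hR' i) _
  calc _ ≤ (N ^ N * A / B) * (∏ i, (R i : ℝ) ^ R i) / (N : ℝ) ^ N * B := by gcongr
    _ = A * ∏ i, (R i : ℝ) ^ R i := by field_simp
    _ = _ := by
      rw [hA, ← Finset.prod_mul_distrib]
      refine Finset.prod_congr rfl fun i _ => ?_
      rw [← mul_pow, div_mul_cancel₀ _ (hR' i).ne']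

theorem scalingInf_pow_le_sum_contingencyTables {N : ℕ} {G : Fin m → Fin n → ℝ}
    (hG : ∀ i j, 0 < G i j) {R : Fin m → ℕ} {C : Fin n → ℕ} (hR : ∀ i, 0 < R i)
    (hC : ∀ j, 0 < C j) (hRN : ∑ i, R i = N) (hCN : ∑ j, C j = N) :
    ((N.factorial : ℝ) / (N : ℝ) ^ (2 * N)) * omegaVec R * omegaVec C *
        scalingInf G (fun i => (R i : ℝ)) (fun j => (C j : ℝ)) ^ N ≤
      ∑ D ∈ contingencyTables R C, ∏ i, ∏ j, G i j ^ D i j / (D i j).factorial := by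
  set f := scalingInf G (fun i => (R i : ℝ)) (fun j => (C j : ℝ)) with hf
  have hRHS : 0 ≤ ∑ D ∈ contingencyTables R C, ∏ i, ∏ j, G i j ^ D i j / (D i j).factorial :=
    Finset.sum_nonneg fun D _ => Finset.prod_nonneg fun i _ => Finset.prod_nonneg fun j _ =>
      div_nonneg (pow_nonneg (hG i j).le _) (Nat.cast_nonneg _)
  have hRP : 0 < ∏ i, (R i : ℝ) ^ R i :=
    Finset.prod_pos fun i _ => pow_pos (by exact_mod_cast hR i) _
  have hCP : 0 < ∏ j, (C j : ℝ) ^ C j :=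
    Finset.prod_pos fun j _ => pow_pos (by exact_mod_cast hC j) _
  have hNN : (0 : ℝ) < (N : ℝ) ^ N := by
    rcases Nat.eq_zero_or_pos N with rfl | hN
    · simp
    · positivity
  rcases (pow_nonneg (scalingInf_nonneg hG (fun i => (R i : ℝ)) (fun j => (C j : ℝ))) N).eq_or_lt
    with h0 | h0
  · rw [hf, ← h0, mul_zero]; exact hRHS
  rw [← hf] at h0
  set K : ℝ := f ^ N * (∏ i, (R i : ℝ) ^ R i) / (N : ℝ) ^ N * ∏ j, (C j : ℝ) ^ C j with hK
  have key := (rowPolynomial_strictlyStable hG R).capacity_mul_le_coeff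
    (hRN ▸ rowPolynomial_isHomogeneous G R) (c := Finsupp.equivFunOnFinite.symm C) (K := K)
    (by simpa using hCN) (by positivity) (fun y hy => by
      have := scalingInf_pow_mul_le hG hR hRN hCN (u := fun j => C j * y j)
        (fun j => mul_pos (by exact_mod_cast hC j) (hy j))
      simp only [mul_pow, Finset.prod_mul_distrib] at this
      simpa [rowPolynomial, hK, mul_assoc] using this)
  rw [coeff_rowPolynomial] at key
  simp only [Finsupp.equivFunOnFinite_symm_apply_apply, Finsupp.coe_equivFunOnFinite_symm] at key
  have hsum : ∑ D ∈ contingencyTables R C,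
      (∏ i, (Nat.multinomial Finset.univ (D i) : ℝ)) * ∏ i, ∏ j, G i j ^ D i j =
      (∏ i, ((R i).factorial : ℝ)) *
        ∑ D ∈ contingencyTables R C, ∏ i, ∏ j, G i j ^ D i j / (D i j).factorial := by
    rw [Finset.mul_sum]
    refine Finset.sum_congr rfl fun D hD => ?_
    rw [← Finset.prod_mul_distrib, ← Finset.prod_mul_distrib]
    refine Finset.prod_congr rfl fun i _ => ?_
    rw [Finset.prod_div_distrib, ← (mem_contingencyTables.1 hD).1 i,
      ← Nat.multinomial_spec Finset.univ (D i)]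
    have : (∏ j, ((D i j).factorial : ℝ)) ≠ 0 :=
      Finset.prod_ne_zero_iff.2 fun j _ => by positivity
    push_cast
    field_simp
  rw [hsum] at key
  have hRf : 0 < ∏ i, ((R i).factorial : ℝ) := Finset.prod_pos fun i _ => by positivity
  have hCf : 0 < ∏ j, ((C j).factorial : ℝ) := Finset.prod_pos fun j _ => by positivity
  refine le_of_mul_le_mul_left ?_ (mul_pos hCf hRf)
  rw [mul_assoc (∏ j, ((C j).factorial : ℝ)) _ (Finset.sum _ _)]
  refine le_trans (le_of_eq ?_) key
  rw [hK, omegaVec, omegaVec, Finset.prod_div_distrib, Finset.prod_div_distrib, two_mul, pow_add]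
  field_simp

theorem integrable_and_integral_exp_density {w : ℝ} (hw : 0 < w) (d : ℕ) :
    Integrable (fun x : ℝ => (if 0 < x then w⁻¹ * Real.exp (-x / w) else 0) *
      (x ^ d / d.factorial)) ∧
    ∫ x : ℝ, (if 0 < x then w⁻¹ * Real.exp (-x / w) else 0) * (x ^ d / d.factorial) = w ^ d := by
  have hind : (fun x : ℝ => (if 0 < x then w⁻¹ * Real.exp (-x / w) else 0) *
      (x ^ d / d.factorial)) = (Set.Ioi (0 : ℝ)).indicator fun x =>
        (w⁻¹ / d.factorial) * (x ^ (((d : ℝ) + 1) - 1) * Real.exp (-(w⁻¹ * x))) := by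
    ext x
    by_cases hx : 0 < x
    · rw [Set.indicator_of_mem (Set.mem_Ioi.2 hx), if_pos hx, add_sub_cancel_right,
        Real.rpow_natCast, neg_div, div_eq_inv_mul x w]
      ring
    · rw [Set.indicator_of_notMem (by simpa using hx), if_neg hx, zero_mul]
  have hint := Real.integral_rpow_mul_exp_neg_mul_Ioi (a := (d : ℝ) + 1) (by positivity)
    (inv_pos.2 hw)
  rw [hind]
  constructor
  · rw [integrable_indicator_iff measurableSet_Ioi]
    refine Integrable.const_mul ?_ _
    refine not_not.1 fun hn => ?_
    rw [integral_undef hn] at hint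
    have : 0 < (1 / w⁻¹) ^ ((d : ℝ) + 1) * Real.Gamma ((d : ℝ) + 1) :=
      mul_pos (by positivity) (Real.Gamma_pos_of_pos (by positivity))
    exact this.ne hint
  · rw [integral_indicator measurableSet_Ioi, integral_const_mul, hint, Real.Gamma_nat_eq_factorial,
      one_div, inv_inv, Real.rpow_add_one hw.ne', Real.rpow_natCast]
    field_simp

theorem integral_expMeasure (W : Fin m → Fin n → ℝ) (hW : ∀ i j, 0 < W i j)
    (g : (Fin m → Fin n → ℝ) → ℝ) :
    ∫ G, g G ∂(expMeasure W) = ∫ G, (∏ i, ∏ j,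
      if 0 < G i j then (W i j)⁻¹ * Real.exp (-(G i j) / W i j) else 0) * g G := by
  have hnn : ∀ G : Fin m → Fin n → ℝ, 0 ≤ ∏ i, ∏ j,
      if 0 < G i j then (W i j)⁻¹ * Real.exp (-(G i j) / W i j) else 0 := fun G =>
    Finset.prod_nonneg fun i _ => Finset.prod_nonneg fun j _ => by
      have := hW i j
      split_ifs <;> positivity
  rw [expMeasure, integral_withDensity_eq_integral_toReal_smul]
  · simp only [ENNReal.toReal_ofReal (hnn _), smul_eq_mul]
  · refine Measurable.ennreal_ofReal ?_
    refine Finset.measurable_prod _ fun i _ => Finset.measurable_prod _ fun j _ => ?_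
    refine Measurable.ite (measurableSet_lt measurable_const (by fun_prop)) (by fun_prop)
      measurable_const
  · exact Filter.Eventually.of_forall fun G => ENNReal.ofReal_lt_top

theorem integral_density_mul_sum_contingencyTables (W : Fin m → Fin n → ℝ)
    (hW : ∀ i j, 0 < W i j) (R : Fin m → ℕ) (C : Fin n → ℕ) :
    Integrable (fun G : Fin m → Fin n → ℝ => (∏ i, ∏ j,
      if 0 < G i j then (W i j)⁻¹ * Real.exp (-(G i j) / W i j) else 0) *
      ∑ D ∈ contingencyTables R C, ∏ i, ∏ j, G i j ^ D i j / (D i j).factorial) ∧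
    ∫ G : Fin m → Fin n → ℝ, (∏ i, ∏ j,
      if 0 < G i j then (W i j)⁻¹ * Real.exp (-(G i j) / W i j) else 0) *
      ∑ D ∈ contingencyTables R C, ∏ i, ∏ j, G i j ^ D i j / (D i j).factorial =
    tableWeight R C W := by
  simp only [Finset.mul_sum, ← Finset.prod_mul_distrib]
  have hrow : ∀ (D : Fin m → Fin n → ℕ) (i : Fin m),
      Integrable (fun v : Fin n → ℝ => ∏ j,
        (if 0 < v j then (W i j)⁻¹ * Real.exp (-(v j) / W i j) else 0) *
          (v j ^ D i j / (D i j).factorial)) := fun D i =>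
    Integrable.fintype_prod fun j => (integrable_and_integral_exp_density (hW i j) (D i j)).1
  have hD : ∀ D : Fin m → Fin n → ℕ,
      Integrable (fun G : Fin m → Fin n → ℝ => ∏ i, ∏ j,
        (if 0 < G i j then (W i j)⁻¹ * Real.exp (-(G i j) / W i j) else 0) *
          (G i j ^ D i j / (D i j).factorial)) := fun D =>
    Integrable.fintype_prod (f := fun i (v : Fin n → ℝ) => ∏ j,
        (if 0 < v j then (W i j)⁻¹ * Real.exp (-(v j) / W i j) else 0) *
          (v j ^ D i j / (D i j).factorial)) fun i => hrow D i
  refine ⟨integrable_finsetSum _ fun D _ => hD D, ?_⟩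
  rw [integral_finsetSum _ fun D _ => hD D, tableWeight_eq_sum]
  refine Finset.sum_congr rfl fun D _ => ?_
  rw [integral_fintype_prod_volume_eq_prod (fun i (v : Fin n → ℝ) => ∏ j,
        (if 0 < v j then (W i j)⁻¹ * Real.exp (-(v j) / W i j) else 0) *
          (v j ^ D i j / (D i j).factorial))]
  refine Finset.prod_congr rfl fun i _ => ?_
  rw [integral_fintype_prod_volume_eq_prod (fun j (x : ℝ) =>
        (if 0 < x then (W i j)⁻¹ * Real.exp (-x / W i j) else 0) *
          (x ^ D i j / (D i j).factorial))]
  exact Finset.prod_congr rfl fun j _ => (integrable_and_integral_exp_density (hW i j) (D i j)).2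

end ContingencyTables

theorem tableWeight_lower_bound_integral {m n N : ℕ}
    (W : Fin m → Fin n → ℝ) (hW : ∀ i j, 0 < W i j)
    (R : Fin m → ℕ) (C : Fin n → ℕ)
    (hRpos : ∀ i, 0 < R i) (hCpos : ∀ j, 0 < C j)
    (hRN : ∑ i, R i = N) (hCN : ∑ j, C j = N) :
    tableWeight R C W ≥
      ((Nat.factorial N : ℝ) / (N : ℝ) ^ (2 * N)) * omegaVec R * omegaVec C *
        ∫ G, scalingInf G (fun i => (R i : ℝ)) (fun j => (C j : ℝ)) ^ N
          ∂(expMeasure W) := by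
  obtain ⟨hint, heq⟩ := integral_density_mul_sum_contingencyTables W hW R C
  rw [integral_expMeasure W hW, ← integral_const_mul, ge_iff_le, ← heq]
  have hω : ∀ {l : ℕ} (B : Fin l → ℕ), 0 ≤ omegaVec B := fun B =>
    Finset.prod_nonneg fun i _ => by positivity
  have hdensity : ∀ G : Fin m → Fin n → ℝ, (∀ i j, 0 < G i j) ∨
      (∏ i, ∏ j, if 0 < G i j then (W i j)⁻¹ * Real.exp (-(G i j) / W i j) else 0) = 0 := by
    intro G
    by_contra! h
    obtain ⟨⟨i, j, hij⟩, hne⟩ := h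
    exact hne (Finset.prod_eq_zero (Finset.mem_univ i) (Finset.prod_eq_zero (Finset.mem_univ j)
      (if_neg hij.not_gt)))
  have hnn : ∀ G : Fin m → Fin n → ℝ, 0 ≤ ∏ i, ∏ j,
      if 0 < G i j then (W i j)⁻¹ * Real.exp (-(G i j) / W i j) else 0 := fun G =>
    Finset.prod_nonneg fun i _ => Finset.prod_nonneg fun j _ => by
      have := hW i j
      split_ifs <;> positivity
  refine integral_mono_of_nonneg (Filter.Eventually.of_forall fun G => ?_) hint
    (Filter.Eventually.of_forall fun G => ?_)
  · rcases hdensity G with hG | hG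
    · have := hω R
      have := hω C
      have := scalingInf_nonneg hG (fun i => (R i : ℝ)) (fun j => (C j : ℝ))
      have := hnn G
      simp only [Pi.zero_apply]
      positivity
    · simp [hG]
  · rcases hdensity G with hG | hG
    · simp only
      rw [mul_left_comm]
      exact mul_le_mul_of_nonneg_left
        (scalingInf_pow_le_sum_contingencyTables hG hRpos hCpos hRN hCN) (hnn G)
    · simp [hG]
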